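/- Let w(n) be a stable sequence with limiting partition (S_1,…,S_r), where r ≥ 2, let 1 ≤ m < r, and set Q = S_1 ∪ … ∪ S_m and R = S_{m+1} ∪ … ∪ S_r. Define u(n) by u(n)_j = C_j^Q·w(n)_j for j ∈ R. Assume that the |R|×|R| matrices f(λ|_R, u(n)) converge entrywise as n → ∞. Then for every N with 2|Q|+1 ≤ N ≤ 2d−1, the sequence f_N(λ, w(n)) converges, and lim_{n→∞} f_N(λ, w(n)) = lim_{n→∞} f_{N−2|Q|}(λ|_R, u(n)). -/

import Mathlib

noncomputable section
open Polynomial Filter Topology ENNReal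

/-- The inner product `⟨p,q⟩_v = ∑ₖ p(μₖ)q(μₖ)vₖ`. -/
def ip {m : ℕ} (μ v : Fin m → ℝ) (p q : ℝ[X]) : ℝ :=
  ∑ k, p.eval (μ k) * q.eval (μ k) * v k

/-- Pair `(pₙ, pₙ₋₁)` of monic orthogonal polynomials (with `p₋₁ = 0`). -/
def opAux {m : ℕ} (μ v : Fin m → ℝ) : ℕ → ℝ[X] × ℝ[X]
  | 0 => (1, 0)
  | n + 1 =>
    let P := opAux μ v n
    ((X - C (ip μ v P.1 (X * P.1) / ip μ v P.1 P.1)) * P.1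
        - C (ip μ v P.1 P.1 / ip μ v P.2 P.2) * P.2, P.1)

/-- The `n`-th monic orthogonal polynomial of the recursion. -/
def op {m : ℕ} (μ v : Fin m → ℝ) (n : ℕ) : ℝ[X] := (opAux μ v n).1

/-- The entry `a_N` of the Jacobi matrix construction: for odd `N = 2n+1` the diagonal
entry `a_{2n+1} = ⟨pₙ, Xpₙ⟩/⟨pₙ,pₙ⟩`, for even `N = 2n` the off-diagonal entry
`a_{2n} = √(⟨pₙ,pₙ⟩/⟨pₙ₋₁,pₙ₋₁⟩)`. -/
def fEnt {m : ℕ} (μ v : Fin m → ℝ) (N : ℕ) : ℝ :=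
  if N % 2 = 1 then
    ip μ v (op μ v (N / 2)) (X * op μ v (N / 2)) / ip μ v (op μ v (N / 2)) (op μ v (N / 2))
  else
    Real.sqrt (ip μ v (op μ v (N / 2)) (op μ v (N / 2)) /
      ip μ v (op μ v (N / 2 - 1)) (op μ v (N / 2 - 1)))

/-- The symmetric tridiagonal matrix `f(μ, v)` with diagonal `a₁,a₃,…` and
sub/super-diagonal `a₂,a₄,…`. -/
def Jmat {m : ℕ} (μ v : Fin m → ℝ) : Matrix (Fin m) (Fin m) ℝ :=
  Matrix.of fun i j =>
    if i = j then fEnt μ v (2 * (i : ℕ) + 1)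
    else if (i : ℕ) + 1 = (j : ℕ) ∨ (j : ℕ) + 1 = (i : ℕ) then fEnt μ v ((i : ℕ) + (j : ℕ) + 1)
    else 0

/-- Restriction of `g : Fin d → ℝ` to a subset `Q`, reindexed in increasing order. -/
def restr {d : ℕ} (Q : Finset (Fin d)) (g : Fin d → ℝ) : Fin Q.card → ℝ :=
  fun k => g ((Q.orderIsoOfFin rfl) k).1

/-- Leading `i × i` principal submatrix. -/
def leadSub {d : ℕ} (J : Matrix (Fin d) (Fin d) ℝ) (i : ℕ) (h : i ≤ d) :
    Matrix (Fin i) (Fin i) ℝ :=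
  Matrix.of fun a b => J ⟨a.1, lt_of_lt_of_le a.2 h⟩ ⟨b.1, lt_of_lt_of_le b.2 h⟩

/-- A sequence of positive weight vectors is stable if all pairwise ratios converge
in `[0,∞]`. -/
def Stable {d : ℕ} (w : ℕ → Fin d → ℝ) : Prop :=
  (∀ n i, 0 < w n i) ∧
    ∀ i j : Fin d, ∃ L : ℝ≥0∞,
      Tendsto (fun n => ENNReal.ofReal (w n i / w n j)) atTop (𝓝 L)

/-- `S : Fin r → Finset (Fin d)` is an ordered partition of `{0,…,d-1}`. -/
def OrdPart {d r : ℕ} (S : Fin r → Finset (Fin d)) : Prop :=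
  (∀ j, (S j).Nonempty) ∧ (∀ j k, j ≠ k → Disjoint (S j) (S k)) ∧
    Finset.univ.biUnion S = (Finset.univ : Finset (Fin d))

/-- `S` is the limiting partition of the stable sequence `w`. -/
def LimPart {d r : ℕ} (w : ℕ → Fin d → ℝ) (S : Fin r → Finset (Fin d)) : Prop :=
  OrdPart S ∧
  (∀ i j : Fin d, (∃ a, i ∈ S a ∧ j ∈ S a) ↔
      ∃ L : ℝ, 0 < L ∧ Tendsto (fun n => w n i / w n j) atTop (𝓝 L)) ∧
  (∀ a b : Fin r, a < b → ∀ i ∈ S a, ∀ j ∈ S b,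
      Tendsto (fun n => w n i / w n j) atTop atTop)

/-- The constant `C_i^T = ∏_{t ∈ T} (λ_t − λ_i)²`. -/
def Cc {d : ℕ} (lam : Fin d → ℝ) (i : Fin d) (T : Finset (Fin d)) : ℝ :=
  ∏ t ∈ T, (lam t - lam i) ^ 2

/-- Offset `∑_{k<j} |S_k|` of the `j`-th block. -/
def offS {d r : ℕ} (S : Fin r → Finset (Fin d)) (j : Fin r) : ℕ :=
  ∑ k ∈ Finset.univ.filter (· < j), (S k).card

/-- The block-diagonal matrix whose `j`-th block (in rows/columns
`offS S j, …, offS S j + |S_j| - 1`) is `Jmat (restr (S j) lam) (restr (S j) (v j))`. -/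
def blockDiag {d r : ℕ} (lam : Fin d → ℝ) (S : Fin r → Finset (Fin d))
    (v : Fin r → Fin d → ℝ) : Matrix (Fin d) (Fin d) ℝ :=
  Matrix.of fun p q =>
    ∑ j : Fin r,
      if h : offS S j ≤ (p : ℕ) ∧ (p : ℕ) < offS S j + (S j).card ∧
          offS S j ≤ (q : ℕ) ∧ (q : ℕ) < offS S j + (S j).card then
        Jmat (restr (S j) lam) (restr (S j) (v j))
          ⟨(p : ℕ) - offS S j, by omega⟩ ⟨(q : ℕ) - offS S j, by omega⟩
      else 0

/-- Nonempty subsets of `Fin d`. -/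
abbrev NES (d : ℕ) := {S : Finset (Fin d) // S.Nonempty}

/-- The ambient Euclidean space of families `(w^S)` indexed by nonempty subsets. -/
abbrev Ew (d : ℕ) := NES d → Fin d → ℝ

/-- The blow-up `B` (normalized representatives): support, nonnegativity,
normalization, and the quadratic equations. -/
def Bset {d : ℕ} (lam : Fin d → ℝ) : Set (Ew d) :=
  {w | (∀ S : NES d, ∀ n, n ∉ S.1 → w S n = 0) ∧
    (∀ S n, 0 ≤ w S n) ∧
    (∀ S : NES d, ∑ n ∈ S.1, w S n = 1) ∧
    ∀ R S : NES d, R.1 ⊆ S.1 → ∀ i ∈ R.1, ∀ j ∈ R.1,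
      Cc lam i (S.1 \ R.1) * w R j * w S i = Cc lam j (S.1 \ R.1) * w R i * w S j}

/-- `𝒥̄^Λ`: symmetric tridiagonal matrices with nonnegative off-diagonal entries and
characteristic polynomial `∏ (X − λ_k)`. -/
def Jset {d : ℕ} (lam : Fin d → ℝ) : Set (Matrix (Fin d) (Fin d) ℝ) :=
  {J | (∀ i j, J i j = J j i) ∧
    (∀ i j : Fin d, (i : ℕ) + 2 ≤ (j : ℕ) ∨ (j : ℕ) + 2 ≤ (i : ℕ) → J i j = 0) ∧
    (∀ i j : Fin d, (i : ℕ) + 1 = (j : ℕ) → 0 ≤ J i j) ∧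
    J.charpoly = ∏ k, (X - C (lam k))}

/-- `K_j = S_j ∪ S_{j+1} ∪ … ∪ S_r`. -/
def Kof {d r : ℕ} (S : Fin r → Finset (Fin d)) (j : Fin r) : Finset (Fin d) :=
  (Finset.univ.filter (j ≤ ·)).biUnion S

/-- The piece `Z(P)` of `B` corresponding to the ordered partition `P = (S_1,…,S_r)`:
for every nonempty `T`, the support of `w^T` is `T ∩ S_{i(T,P)}`. -/
def Zset {d : ℕ} (lam : Fin d → ℝ) {r : ℕ} (S : Fin r → Finset (Fin d)) : Set (Ew d) :=
  {w | w ∈ Bset lam ∧ ∀ T : NES d, ∃ j : Fin r, T.1 ⊆ Kof S j ∧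
    (∀ k, T.1 ⊆ Kof S k → k ≤ j) ∧ ∀ n : Fin d, w T n ≠ 0 ↔ n ∈ T.1 ∧ n ∈ S j}

/-- `R ⪯ S`: the ordered partition `R` refines `S`, i.e. `R` is the concatenation of
ordered partitions of `S_1`, then `S_2`, etc. -/
def Refines {d q r : ℕ} (R : Fin q → Finset (Fin d)) (S : Fin r → Finset (Fin d)) : Prop :=
  ∃ b : Fin (r + 1) → ℕ, b 0 = 0 ∧ b (Fin.last r) = q ∧
    (∀ i j : Fin (r + 1), i ≤ j → b i ≤ b j) ∧
    ∀ i : Fin r, S i = (Finset.univ.filter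
      (fun k : Fin q => b i.castSucc ≤ (k : ℕ) ∧ (k : ℕ) < b i.succ)).biUnion R

/-- The `j`-th consecutive interval `I_j(T)` of lengths `|T_1|,…,|T_r|`. -/
def Iint {d r : ℕ} (T : Fin r → Finset (Fin d)) (j : Fin r) : Finset (Fin d) :=
  Finset.univ.filter (fun m : Fin d => offS T j ≤ (m : ℕ) ∧ (m : ℕ) < offS T j + (T j).card)

/-- `H(T) = {σ : σ(T_j) = I_j(T) for all j}`. -/
def Hset {d r : ℕ} (T : Fin r → Finset (Fin d)) : Set (Equiv.Perm (Fin d)) :=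
  {σ | ∀ j, (T j).image σ = Iint T j}

/-- Interval Young subgroups: setwise stabilizers of a division of `{0,…,d-1}` into
consecutive intervals. -/
def IsIntervalYoung {d : ℕ} (G : Set (Equiv.Perm (Fin d))) : Prop :=
  ∃ (q : ℕ) (c : Fin q → Finset (Fin d)), OrdPart c ∧ (∀ j : Fin q, c j = Iint c j) ∧
    G = {τ : Equiv.Perm (Fin d) | ∀ j, (c j).image ⇑τ = c j}

/-- Number of surjections from an `a`-element set onto a `b`-element set. -/
def Surj (a b : ℕ) : ℕ := Fintype.card {f : Fin a → Fin b // Function.Surjective f}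

/-- The Euler characteristic `χ_d = ∑_{q=1}^d (−2)^{d−q}·Surj(d,q)`. -/
def chi (a : ℕ) : ℝ := ∑ q ∈ Finset.Icc 1 a, (-2 : ℝ) ^ (a - q) * (Surj a q : ℝ)

open Finset

/-- The squared Vandermonde determinant of the points `μ k`, `k ∈ A`, times their weights. -/
def subsetWeight {ι : Type*} [DecidableEq ι] (μ v : ι → ℝ) (A : Finset ι) : ℝ :=
  (∏ i ∈ A, ∏ j ∈ A.erase i, |μ i - μ j|) * ∏ i ∈ A, v i

/-- The sum over the `n`-element subsets `A` of `s` of `g A` times the weight of `A`. For `g = 1`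
this is the `n`-th Hankel determinant of the discrete measure with weights `v`. -/
def weightedSubsetSum {ι : Type*} [DecidableEq ι] (μ v : ι → ℝ) (s : Finset ι) (n : ℕ)
    (g : Finset ι → ℝ) : ℝ :=
  ∑ A ∈ s.powersetCard n, subsetWeight μ v A * g A

section SubsetSums

variable {ι κ : Type*} [DecidableEq ι] [DecidableEq κ]

lemma subsetWeight_insert (μ v : ι → ℝ) {j : ι} {A : Finset ι} (hj : j ∉ A) :
    subsetWeight μ v (insert j A) =
      subsetWeight μ v A * (∏ k ∈ A, (μ j - μ k)) ^ 2 * v j := by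
  have h : ∀ i ∈ A, ∏ k ∈ (insert j A).erase i, |μ i - μ k| =
      |μ j - μ i| * ∏ k ∈ A.erase i, |μ i - μ k| := fun i hi => by
    have hij : j ≠ i := fun h => hj (h ▸ hi)
    rw [erase_insert_of_ne hij, prod_insert (fun h => hj (mem_of_mem_erase h)), abs_sub_comm]
  rw [subsetWeight, prod_insert hj, prod_insert hj, erase_insert hj, prod_congr rfl h,
    prod_mul_distrib, ← sq_abs (∏ k ∈ A, (μ j - μ k)), abs_prod, subsetWeight]
  ring

lemma subsetWeight_pos {μ v : ι → ℝ} (hμ : Function.Injective μ) (A : Finset ι)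
    (hv : ∀ i ∈ A, 0 < v i) : 0 < subsetWeight μ v A :=
  mul_pos (prod_pos fun _ _ => prod_pos fun _ hj =>
    abs_pos.2 (sub_ne_zero.2 (hμ.ne (ne_of_mem_erase hj).symm))) (prod_pos hv)

lemma subsetWeight_map (μ v : ι → ℝ) (e : κ ↪ ι) (A : Finset κ) :
    subsetWeight (μ ∘ e) (v ∘ e) A = subsetWeight μ v (A.map e) := by
  simp [subsetWeight, ← map_erase]

lemma weightedSubsetSum_map (μ v : ι → ℝ) (e : κ ↪ ι) (s : Finset κ) (n : ℕ) (g : Finset ι → ℝ) :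
    weightedSubsetSum (μ ∘ e) (v ∘ e) s n (fun A => g (A.map e)) = weightedSubsetSum μ v (s.map e) n g := by
  simp [weightedSubsetSum, powersetCard_map, subsetWeight_map]

lemma weightedSubsetSum_one_pos {μ v : ι → ℝ} (hμ : Function.Injective μ) {s : Finset ι}
    (hv : ∀ i ∈ s, 0 < v i) {n : ℕ} (hn : n ≤ s.card) : 0 < weightedSubsetSum μ v s n 1 :=
  sum_pos (fun A hA => by
    simpa using subsetWeight_pos hμ A fun i hi => hv i ((mem_powersetCard.1 hA).1 hi))
    (powersetCard_nonempty.2 hn)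

end SubsetSums

section OrthogonalPolynomials

variable {m : ℕ} (μ v : Fin m → ℝ)

lemma ip_comm (p q : ℝ[X]) : ip μ v p q = ip μ v q p := by
  simp only [ip, mul_comm (p.eval _)]

lemma ip_sub_left (p p' q : ℝ[X]) : ip μ v (p - p') q = ip μ v p q - ip μ v p' q := by
  simp [ip, sub_mul]

lemma ip_C_mul_left (c : ℝ) (p q : ℝ[X]) : ip μ v (C c * p) q = c * ip μ v p q := by
  simp [ip, mul_sum, mul_assoc]

lemma ip_X_mul_left (p q : ℝ[X]) : ip μ v (X * p) q = ip μ v p (X * q) := by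
  simp only [ip, eval_mul, eval_X]
  exact sum_congr rfl fun _ _ => by ring

lemma ip_sum_left {κ : Type*} (s : Finset κ) (p : κ → ℝ[X]) (q : ℝ[X]) :
    ip μ v (∑ a ∈ s, p a) q = ∑ a ∈ s, ip μ v (p a) q := by
  simp only [ip, eval_finsetSum, sum_mul]
  exact sum_comm

variable {μ v}

lemma eq_zero_of_ip_self_eq_zero (hμ : Function.Injective μ) (hv : ∀ i, 0 < v i) {p : ℝ[X]}
    (hdeg : p.natDegree < m) (h : ip μ v p p = 0) : p = 0 := by
  refine eq_zero_of_natDegree_lt_card_of_eval_eq_zero p hμ (fun i => ?_) (by simpa using hdeg)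
  have := (sum_eq_zero_iff_of_nonneg fun i _ =>
    mul_nonneg (mul_self_nonneg (p.eval (μ i))) (hv i).le).1 h i (mem_univ i)
  simpa [(hv i).ne'] using this

variable (μ v) in
/-- The `n`-th Hankel determinant times the `n`-th monic orthogonal polynomial. -/
def subsetPoly (n : ℕ) : ℝ[X] :=
  ∑ A ∈ univ.powersetCard n, C (subsetWeight μ v A) * ∏ k ∈ A, (X - C (μ k))

lemma ip_subsetPoly (hμ : Function.Injective μ) {n : ℕ} {q : ℝ[X]} (hq : q.natDegree ≤ n) :
    ip μ v (subsetPoly μ v n) q = weightedSubsetSum μ v univ (n + 1) 1 * q.coeff n := by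
  have hcoeff : ∀ B ∈ univ.powersetCard (n + 1),
      q.coeff n = ∑ j ∈ B, q.eval (μ j) / ∏ k ∈ B.erase j, (μ j - μ k) := fun B hB => by
    have hc : B.card = n + 1 := (mem_powersetCard.1 hB).2
    rw [← Lagrange.coeff_eq_sum hμ.injOn, hc, Nat.add_sub_cancel]
    exact (degree_le_of_natDegree_le hq).trans_lt (by rw [hc]; exact_mod_cast Nat.lt_succ_self n)
  have hterm : ∀ A ∈ univ.powersetCard n,
      ip μ v (C (subsetWeight μ v A) * ∏ k ∈ A, (X - C (μ k))) q =
        ∑ j ∈ univ \ A, subsetWeight μ v (insert j A) *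
          (q.eval (μ j) / ∏ k ∈ A, (μ j - μ k)) := fun A _ => by
    rw [ip_C_mul_left, ip, mul_sum, ← sum_subset (subset_univ (univ \ A))]
    · refine sum_congr rfl fun j hj => ?_
      have hj' : j ∉ A := (mem_sdiff.1 hj).2
      have hne : ∏ k ∈ A, (μ j - μ k) ≠ 0 :=
        prod_ne_zero_iff.2 fun k hk => sub_ne_zero.2 (hμ.ne fun h => hj' (h ▸ hk))
      rw [subsetWeight_insert _ _ hj', eval_prod]
      simp only [eval_sub, eval_X, eval_C]
      field_simp
    · intro j _ hj
      have hj' : j ∈ A := by simpa using hj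
      rw [eval_prod, prod_eq_zero hj' (by simp)]
      simp
  have hsum : weightedSubsetSum μ v univ (n + 1) 1 * q.coeff n =
      ∑ B ∈ univ.powersetCard (n + 1), ∑ j ∈ B,
        subsetWeight μ v B * (q.eval (μ j) / ∏ k ∈ B.erase j, (μ j - μ k)) := by
    rw [weightedSubsetSum, sum_mul]
    refine sum_congr rfl fun B hB => ?_
    rw [hcoeff B hB, mul_sum, Pi.one_apply, mul_one]
  rw [hsum, subsetPoly, ip_sum_left, sum_congr rfl hterm, sum_sigma', sum_sigma']
  refine sum_bij' (fun x _ => ⟨insert x.2 x.1, x.2⟩) (fun x _ => ⟨x.1.erase x.2, x.2⟩)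
    ?_ ?_ ?_ ?_ ?_
  · rintro ⟨A, j⟩ h
    simp_all [mem_powersetCard]
  · rintro ⟨A, j⟩ h
    simp_all [mem_powersetCard]
  · rintro ⟨A, j⟩ h
    simp_all [mem_powersetCard]
  · rintro ⟨A, j⟩ h
    simp_all [mem_powersetCard]
  · rintro ⟨A, j⟩ h
    simp_all [mem_powersetCard]

variable (μ v) in
/-- The normalization of `subsetPoly`, an explicit form of the monic orthogonal polynomials. -/
def orthPoly (n : ℕ) : ℝ[X] :=
  C (weightedSubsetSum μ v univ n 1)⁻¹ * subsetPoly μ v n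

lemma natDegree_subsetPoly_le (n : ℕ) : (subsetPoly μ v n).natDegree ≤ n :=
  natDegree_sum_le_of_forall_le _ _ fun A hA => (natDegree_C_mul_le _ _).trans
    (by rw [natDegree_finsetProd_X_sub_C_eq_card, (mem_powersetCard.1 hA).2])

lemma natDegree_orthPoly_le (n : ℕ) : (orthPoly μ v n).natDegree ≤ n :=
  (natDegree_C_mul_le _ _).trans (natDegree_subsetPoly_le n)

lemma coeff_orthPoly (hμ : Function.Injective μ) (hv : ∀ i, 0 < v i) {n : ℕ} (hn : n ≤ m) :
    (orthPoly μ v n).coeff n = 1 := by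
  have h : (subsetPoly μ v n).coeff n = weightedSubsetSum μ v univ n 1 := by
    rw [subsetPoly, finsetSum_coeff, weightedSubsetSum]
    refine sum_congr rfl fun A hA => ?_
    have hc := (mem_powersetCard.1 hA).2
    have hd : (∏ k ∈ A, (X - C (μ k))).natDegree = n := by
      rw [natDegree_finsetProd_X_sub_C_eq_card, hc]
    have := (monic_prod_X_sub_C μ A).coeff_natDegree
    rw [hd] at this
    simp [coeff_C_mul, this]
  rw [orthPoly, coeff_C_mul, h]
  exact inv_mul_cancel₀ (weightedSubsetSum_one_pos hμ (fun i _ => hv i) (by simpa)).ne'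

lemma coeff_X_mul_orthPoly (n : ℕ) :
    (X * orthPoly μ v n).coeff n =
      -(weightedSubsetSum μ v univ n (fun A => ∑ k ∈ A, μ k) / weightedSubsetSum μ v univ n 1) := by
  have h : (X * subsetPoly μ v n).coeff n = -weightedSubsetSum μ v univ n (fun A => ∑ k ∈ A, μ k) := by
    rw [subsetPoly, mul_sum, finsetSum_coeff, weightedSubsetSum, ← sum_neg_distrib]
    refine sum_congr rfl fun A hA => ?_
    have hc := (mem_powersetCard.1 hA).2
    rw [mul_left_comm, coeff_C_mul]
    rcases n with _ | n
    · rw [card_eq_zero.1 hc]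
      simp
    · have := prod_X_sub_C_coeff_card_pred A μ (by omega)
      rw [hc, Nat.add_sub_cancel] at this
      rw [coeff_X_mul, this]
      ring
  rw [orthPoly, mul_left_comm, coeff_C_mul, h]
  ring

lemma ip_orthPoly (hμ : Function.Injective μ) {n : ℕ} {q : ℝ[X]} (hq : q.natDegree ≤ n) :
    ip μ v (orthPoly μ v n) q =
      weightedSubsetSum μ v univ (n + 1) 1 / weightedSubsetSum μ v univ n 1 * q.coeff n := by
  rw [orthPoly, ip_C_mul_left, ip_subsetPoly hμ hq]
  ring

lemma ip_orthPoly_self (hμ : Function.Injective μ) (hv : ∀ i, 0 < v i) {n : ℕ} (hn : n ≤ m) :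
    ip μ v (orthPoly μ v n) (orthPoly μ v n) =
      weightedSubsetSum μ v univ (n + 1) 1 / weightedSubsetSum μ v univ n 1 := by
  rw [ip_orthPoly hμ (natDegree_orthPoly_le n), coeff_orthPoly hμ hv hn, mul_one]

lemma natDegree_le_pred_of_coeff_eq_zero {p : ℝ[X]} {n : ℕ} (h : p.natDegree ≤ n + 1)
    (hc : p.coeff (n + 1) = 0) : p.natDegree ≤ n := by
  rw [natDegree_le_iff_coeff_eq_zero] at h ⊢
  intro N hN
  rcases (Nat.succ_le_of_lt hN).eq_or_lt with rfl | hlt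
  · exact hc
  · exact h N hlt

lemma natDegree_X_mul_le {p : ℝ[X]} {n : ℕ} (h : p.natDegree ≤ n) :
    (X * p).natDegree ≤ n + 1 :=
  natDegree_mul_le.trans (by rw [natDegree_X]; omega)

lemma ip_orthPoly_self_ne_zero (hμ : Function.Injective μ) (hv : ∀ i, 0 < v i) {n : ℕ}
    (hn : n + 1 ≤ m) : weightedSubsetSum μ v univ (n + 1) 1 / weightedSubsetSum μ v univ n 1 ≠ 0 :=
  (div_pos (weightedSubsetSum_one_pos hμ (fun i _ => hv i) (by simpa))
    (weightedSubsetSum_one_pos hμ (fun i _ => hv i) (by simp; omega))).ne'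

lemma natDegree_X_mul_orthPoly_sub_le (hμ : Function.Injective μ) (hv : ∀ i, 0 < v i) {n : ℕ}
    (hn : n + 1 ≤ m) : (X * orthPoly μ v n - orthPoly μ v (n + 1)).natDegree ≤ n := by
  refine natDegree_le_pred_of_coeff_eq_zero
    ((natDegree_sub_le _ _).trans (max_le (natDegree_X_mul_le (natDegree_orthPoly_le n))
      (natDegree_orthPoly_le _))) ?_
  rw [coeff_sub, coeff_X_mul, coeff_orthPoly hμ hv hn, coeff_orthPoly hμ hv (by omega), sub_self]

lemma orthPoly_one (hμ : Function.Injective μ) (hv : ∀ i, 0 < v i) (hm : 1 ≤ m) :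
    orthPoly μ v 0 = 1 ∧ orthPoly μ v 1 = X * orthPoly μ v 0 -
      C (ip μ v (orthPoly μ v 0) (X * orthPoly μ v 0) /
        ip μ v (orthPoly μ v 0) (orthPoly μ v 0)) * orthPoly μ v 0 := by
  have h0 : orthPoly μ v 0 = 1 := by
    rw [eq_C_of_natDegree_le_zero (natDegree_orthPoly_le 0), coeff_orthPoly hμ hv (Nat.zero_le m),
      C_1]
  refine ⟨h0, ?_⟩
  set a := ip μ v (orthPoly μ v 0) (X * orthPoly μ v 0) /
    ip μ v (orthPoly μ v 0) (orthPoly μ v 0) with ha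
  have hκ := ip_orthPoly_self_ne_zero hμ hv hm
  have hself := ip_orthPoly_self hμ hv (Nat.zero_le m)
  set δ := X * orthPoly μ v 0 - orthPoly μ v 1 - C a * orthPoly μ v 0 with hδ
  have hdeg : δ.natDegree ≤ 0 := (natDegree_sub_le _ _).trans
    (max_le (natDegree_X_mul_orthPoly_sub_le hμ hv hm)
      ((natDegree_C_mul_le _ _).trans (natDegree_orthPoly_le 0)))
  have hip : ip μ v δ (orthPoly μ v 0) = 0 := by
    rw [hδ, ip_sub_left, ip_sub_left, ip_C_mul_left, ip_orthPoly hμ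
      ((natDegree_orthPoly_le 0).trans (Nat.zero_le 1)),
      coeff_eq_zero_of_natDegree_lt ((natDegree_orthPoly_le 0).trans_lt Nat.one_pos), ha,
      div_mul_cancel₀ _ (hself ▸ hκ), ip_X_mul_left]
    ring
  rw [ip_comm, ip_orthPoly hμ hdeg] at hip
  have hc := (mul_eq_zero.1 hip).resolve_left hκ
  have : δ = 0 := by rw [eq_C_of_natDegree_le_zero hdeg, hc, C_0]
  linear_combination -this + hδ

lemma orthPoly_add_two (hμ : Function.Injective μ) (hv : ∀ i, 0 < v i) {n : ℕ}
    (hn : n + 2 ≤ m) :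
    orthPoly μ v (n + 2) = X * orthPoly μ v (n + 1) -
      C (ip μ v (orthPoly μ v (n + 1)) (X * orthPoly μ v (n + 1)) /
        ip μ v (orthPoly μ v (n + 1)) (orthPoly μ v (n + 1))) * orthPoly μ v (n + 1) -
      C (ip μ v (orthPoly μ v (n + 1)) (orthPoly μ v (n + 1)) /
        ip μ v (orthPoly μ v n) (orthPoly μ v n)) * orthPoly μ v n := by
  have hκ := ip_orthPoly_self_ne_zero hμ hv (n := n) (by omega)
  have hκ' := ip_orthPoly_self_ne_zero hμ hv (n := n + 1) hn
  have hself := ip_orthPoly_self hμ hv (n := n) (by omega)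
  have hself' := ip_orthPoly_self hμ hv (n := n + 1) (by omega)
  set a := ip μ v (orthPoly μ v (n + 1)) (X * orthPoly μ v (n + 1)) /
    ip μ v (orthPoly μ v (n + 1)) (orthPoly μ v (n + 1)) with ha
  set b := ip μ v (orthPoly μ v (n + 1)) (orthPoly μ v (n + 1)) /
    ip μ v (orthPoly μ v n) (orthPoly μ v n) with hb
  set δ := X * orthPoly μ v (n + 1) - orthPoly μ v (n + 2) - C a * orthPoly μ v (n + 1) -
    C b * orthPoly μ v n with hδ
  have hexpand : ∀ q : ℝ[X], ip μ v δ q = ip μ v (orthPoly μ v (n + 1)) (X * q) -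
      ip μ v (orthPoly μ v (n + 2)) q - a * ip μ v (orthPoly μ v (n + 1)) q -
      b * ip μ v (orthPoly μ v n) q := fun q => by
    rw [hδ, ip_sub_left, ip_sub_left, ip_sub_left, ip_C_mul_left, ip_C_mul_left, ip_X_mul_left]
  have hlow : ∀ {k : ℕ} {q : ℝ[X]}, q.natDegree < k → ip μ v (orthPoly μ v k) q = 0 :=
    fun {k q} h => by
      rw [ip_orthPoly hμ h.le, coeff_eq_zero_of_natDegree_lt h, mul_zero]
  have hlt : ∀ k l, k < l → (orthPoly μ v k).natDegree < l := fun k l h =>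
    (natDegree_orthPoly_le k).trans_lt h
  have hdeg : δ.natDegree ≤ n + 1 := by
    refine (natDegree_sub_le _ _).trans (max_le ((natDegree_sub_le _ _).trans (max_le
      (natDegree_X_mul_orthPoly_sub_le hμ hv hn) ((natDegree_C_mul_le _ _).trans
        (natDegree_orthPoly_le _)))) ((natDegree_C_mul_le _ _).trans (hlt _ _ ?_).le))
    omega
  have h1 : ip μ v δ (orthPoly μ v (n + 1)) = 0 := by
    rw [hexpand, hlow (hlt _ (n + 2) (by omega)), ip_comm μ v (orthPoly μ v n),
      hlow (hlt n (n + 1) (by omega)), ha, div_mul_cancel₀ _ (hself' ▸ hκ')]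
    ring
  rw [ip_comm, ip_orthPoly hμ hdeg] at h1
  have hdeg' := natDegree_le_pred_of_coeff_eq_zero hdeg ((mul_eq_zero.1 h1).resolve_left hκ')
  have h2 : ip μ v δ (orthPoly μ v n) = 0 := by
    rw [hexpand, hlow (hlt _ (n + 2) (by omega)), hlow (hlt n (n + 1) (by omega)), hb,
      div_mul_cancel₀ _ (hself ▸ hκ), ip_orthPoly hμ (natDegree_X_mul_le (natDegree_orthPoly_le n)),
      coeff_X_mul, coeff_orthPoly hμ hv (by omega), hself']
    ring
  rw [ip_comm, ip_orthPoly hμ hdeg'] at h2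
  have hc := (mul_eq_zero.1 h2).resolve_left hκ
  have h3 : ip μ v δ δ = 0 := by
    rw [hexpand, ip_orthPoly hμ (natDegree_X_mul_le hdeg'), coeff_X_mul, ip_orthPoly hμ hdeg', hc,
      hlow (k := n + 2) (by omega), hlow (k := n + 1) (by omega)]
    ring
  have h4 := eq_zero_of_ip_self_eq_zero hμ hv (by omega) h3
  linear_combination -h4 + hδ

lemma opAux_succ (hμ : Function.Injective μ) (hv : ∀ i, 0 < v i) {n : ℕ} (hn : n + 1 ≤ m) :
    opAux μ v (n + 1) = (orthPoly μ v (n + 1), orthPoly μ v n) := by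
  induction n with
  | zero =>
    obtain ⟨h0, h1⟩ := orthPoly_one hμ hv hn
    rw [zero_add, h1, h0]
    simp [opAux]
  | succ n ih =>
    rw [opAux, ih (by omega), orthPoly_add_two hμ hv hn]
    simp only [sub_mul]

lemma op_eq_orthPoly (hμ : Function.Injective μ) (hv : ∀ i, 0 < v i) {n : ℕ} (hn : n ≤ m)
    (hm : 1 ≤ m) : op μ v n = orthPoly μ v n := by
  rcases n with _ | n
  · rw [(orthPoly_one hμ hv hm).1, op, opAux]
  · rw [op, opAux_succ hμ hv hn]

/-- The diagonal entries as differences of weighted averages over subsets. -/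
lemma fEnt_odd (hμ : Function.Injective μ) (hv : ∀ i, 0 < v i) {n : ℕ} (hn : n + 1 ≤ m) :
    fEnt μ v (2 * n + 1) =
      weightedSubsetSum μ v univ (n + 1) (fun A => ∑ k ∈ A, μ k) / weightedSubsetSum μ v univ (n + 1) 1 -
      weightedSubsetSum μ v univ n (fun A => ∑ k ∈ A, μ k) / weightedSubsetSum μ v univ n 1 := by
  have hκ := ip_orthPoly_self_ne_zero hμ hv hn
  have hdeg := natDegree_X_mul_orthPoly_sub_le hμ hv hn
  have horth : ip μ v (orthPoly μ v (n + 1)) (orthPoly μ v n) = 0 := by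
    have := (natDegree_orthPoly_le (μ := μ) (v := v) n).trans_lt (Nat.lt_succ_self n)
    rw [ip_orthPoly hμ this.le, coeff_eq_zero_of_natDegree_lt this, mul_zero]
  have hip := ip_orthPoly (v := v) hμ hdeg
  rw [ip_comm, ip_sub_left, horth, coeff_sub, sub_zero, coeff_X_mul_orthPoly,
    ← coeff_X_mul (orthPoly μ v (n + 1)) n, coeff_X_mul_orthPoly, ip_comm] at hip
  have h2 : (2 * n + 1) / 2 = n := by omega
  rw [fEnt, if_pos (by omega), h2, op_eq_orthPoly hμ hv (by omega) (by omega), hip,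
    ip_orthPoly_self hμ hv (by omega), mul_div_cancel_left₀ _ hκ]
  ring

/-- The off-diagonal entries in terms of Hankel determinants. -/
lemma fEnt_even (hμ : Function.Injective μ) (hv : ∀ i, 0 < v i) {n : ℕ} (hn : n + 2 ≤ m) :
    fEnt μ v (2 * (n + 1)) =
      √(weightedSubsetSum μ v univ (n + 2) 1 / weightedSubsetSum μ v univ (n + 1) 1 /
        (weightedSubsetSum μ v univ (n + 1) 1 / weightedSubsetSum μ v univ n 1)) := by
  have h2 : 2 * (n + 1) / 2 = n + 1 := by omega
  rw [fEnt, if_neg (by omega), h2, Nat.add_sub_cancel,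
    op_eq_orthPoly hμ hv (by omega) (by omega), op_eq_orthPoly hμ hv (by omega) (by omega),
    ip_orthPoly_self hμ hv (by omega), ip_orthPoly_self hμ hv (by omega)]

end OrthogonalPolynomials

section Asymptotics

variable {ι : Type*}

lemma tendsto_prod_div_prod_zero {w : ℕ → ι → ℝ} {s t : Finset ι} (hcard : s.card = t.card)
    (hs : s.Nonempty)
    (h : ∀ i ∈ s, ∀ j ∈ t, Tendsto (fun n => w n i / w n j) atTop (𝓝 0)) :
    Tendsto (fun n => (∏ i ∈ s, w n i) / ∏ j ∈ t, w n j) atTop (𝓝 0) := by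
  let e := equivOfCardEq hcard
  have hprod : Tendsto (fun n => ∏ i : s, w n i / w n (e i)) atTop (𝓝 (∏ _i : s, 0)) :=
    tendsto_finsetProd _ fun i _ => h i i.2 (e i) (e i).2
  rw [prod_const, zero_pow (by simpa using hs.card_pos.ne')] at hprod
  refine hprod.congr fun n => ?_
  rw [← prod_coe_sort s, ← prod_coe_sort t, ← e.prod_comp (fun j => w n j)]
  exact Finset.prod_div_distrib _ _

variable [DecidableEq ι]

lemma subsetWeight_union (μ v : ι → ℝ) {Q B : Finset ι} (h : Disjoint Q B) :
    subsetWeight μ v (Q ∪ B) =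
      subsetWeight μ v Q * subsetWeight μ (fun j => (∏ t ∈ Q, (μ t - μ j) ^ 2) * v j) B := by
  induction B using Finset.induction_on with
  | empty => simp [subsetWeight]
  | insert j B hj ih =>
    rw [disjoint_insert_right] at h
    have hQ : ∏ t ∈ Q, (μ t - μ j) ^ 2 = (∏ t ∈ Q, (μ j - μ t)) ^ 2 := by
      rw [← prod_pow]
      exact prod_congr rfl fun _ _ => by ring
    rw [union_insert, subsetWeight_insert _ _ (by simp [h.1, hj]), ih h.2,
      subsetWeight_insert _ _ hj, prod_union h.2, hQ]
    ring

variable [Fintype ι] {μ : ι → ℝ} {w : ℕ → ι → ℝ} {Q : Finset ι}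

lemma tendsto_subsetWeight_div_zero (hw : ∀ n i, 0 < w n i)
    (hQ : ∀ i ∈ Q, ∀ j ∉ Q, Tendsto (fun n => w n j / w n i) atTop (𝓝 0))
    {k : ℕ} {A : Finset ι} (hA : A.card = Q.card + k) (hQA : ¬ Q ⊆ A) :
    ∃ B ∈ Qᶜ.powersetCard k, Tendsto
      (fun n => subsetWeight μ (w n) A / subsetWeight μ (w n) (Q ∪ B)) atTop (𝓝 0) := by
  have hlt : (Q ∩ A).card < Q.card :=
    card_lt_card ⟨inter_subset_left, fun h => hQA fun i hi => (mem_inter.1 (h hi)).2⟩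
  have hsplit := card_inter_add_card_sdiff A Q
  rw [inter_comm] at hsplit
  obtain ⟨B, hB, hBk⟩ := exists_subset_card_eq (s := A \ Q) (n := k) (by omega)
  have hBQ : Disjoint Q B := disjoint_left.2 fun i hi hiB => (mem_sdiff.1 (hB hiB)).2 hi
  refine ⟨B, mem_powersetCard.2 ⟨fun i hi => by simpa using (mem_sdiff.1 (hB hi)).2, hBk⟩, ?_⟩
  have hAQ : A \ (Q ∪ B) = (A \ Q) \ B := by rw [sdiff_sdiff_left, sup_eq_union]
  have hQB : (Q ∪ B) \ A = Q \ A := by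
    rw [union_sdiff_distrib, sdiff_eq_empty_iff_subset.2 (hB.trans sdiff_subset), union_empty]
  have hc1 : (A \ (Q ∪ B)).card = (Q \ A).card := by
    have := card_inter_add_card_sdiff Q A
    rw [hAQ, card_sdiff_of_subset hB]
    omega
  have hne : (A \ (Q ∪ B)).Nonempty := by
    rw [← card_pos, hc1, card_pos, sdiff_nonempty]
    exact hQA
  have hlim := tendsto_prod_div_prod_zero (w := w) (t := (Q ∪ B) \ A) (by rw [hc1, hQB]) hne
    fun i hi j hj => hQ j (mem_sdiff.1 (hQB ▸ hj)).1 i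
      fun h => (mem_sdiff.1 hi).2 (mem_union_left _ h)
  have hmul := hlim.const_mul ((∏ i ∈ A, ∏ j ∈ A.erase i, |μ i - μ j|) /
    ∏ i ∈ Q ∪ B, ∏ j ∈ (Q ∪ B).erase i, |μ i - μ j|)
  rw [mul_zero] at hmul
  refine hmul.congr fun n => ?_
  have hcap : ∏ i ∈ A ∩ (Q ∪ B), w n i ≠ 0 := (prod_pos fun i _ => hw n i).ne'
  rw [subsetWeight, subsetWeight, ← prod_inter_mul_prod_sdiff A (Q ∪ B) (w n),
    ← prod_inter_mul_prod_sdiff (Q ∪ B) A (w n), inter_comm (Q ∪ B) A, mul_div_mul_comm,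
    mul_div_mul_left _ _ hcap]

lemma tendsto_weightedSubsetSum_div_sub (hμ : Function.Injective μ) (hw : ∀ n i, 0 < w n i)
    (hQ : ∀ i ∈ Q, ∀ j ∉ Q, Tendsto (fun n => w n j / w n i) atTop (𝓝 0))
    {u : ℕ → ι → ℝ} (hu : ∀ n j, u n j = (∏ t ∈ Q, (μ t - μ j) ^ 2) * w n j)
    (k : ℕ) (g : Finset ι → ℝ) :
    Tendsto (fun n => weightedSubsetSum μ (w n) univ (Q.card + k) g /
        (subsetWeight μ (w n) Q * weightedSubsetSum μ (u n) Qᶜ k 1) -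
      weightedSubsetSum μ (u n) Qᶜ k (fun B => g (Q ∪ B)) / weightedSubsetSum μ (u n) Qᶜ k 1)
      atTop (𝓝 0) := by
  have hunion : ∀ n, ∀ B ∈ Qᶜ.powersetCard k,
      subsetWeight μ (w n) (Q ∪ B) = subsetWeight μ (w n) Q * subsetWeight μ (u n) B :=
    fun n B hB => by
      rw [subsetWeight_union _ _ (disjoint_left.2 fun i hi hiB =>
        (mem_compl.1 ((mem_powersetCard.1 hB).1 hiB)) hi), ← funext (hu n)]
  have hpos : ∀ n A, 0 < subsetWeight μ (w n) A := fun n A =>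
    subsetWeight_pos hμ A fun i _ => hw n i
  have hmain : ∀ n, ∑ A ∈ univ.powersetCard (Q.card + k) with Q ⊆ A, subsetWeight μ (w n) A * g A =
      subsetWeight μ (w n) Q * weightedSubsetSum μ (u n) Qᶜ k (fun B => g (Q ∪ B)) := fun n => by
    rw [weightedSubsetSum, mul_sum]
    refine sum_bij' (fun A _ => A \ Q) (fun B _ => Q ∪ B) ?_ ?_ ?_ ?_ ?_
    · intro A hA
      obtain ⟨hA, hQA⟩ := mem_filter.1 hA
      rw [mem_powersetCard, card_sdiff_of_subset hQA, (mem_powersetCard.1 hA).2]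
      exact ⟨fun i hi => by simpa using (mem_sdiff.1 hi).2, by omega⟩
    · intro B hB
      obtain ⟨hB, hc⟩ := mem_powersetCard.1 hB
      rw [mem_filter, mem_powersetCard, card_union_of_disjoint
        (disjoint_left.2 fun i hi hiB => (mem_compl.1 (hB hiB)) hi), hc]
      exact ⟨⟨subset_univ _, rfl⟩, subset_union_left⟩
    · intro A hA
      exact union_sdiff_of_subset (mem_filter.1 hA).2
    · intro B hB
      exact union_sdiff_cancel_left
        (disjoint_left.2 fun i hi hiB => (mem_compl.1 ((mem_powersetCard.1 hB).1 hiB)) hi)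
    · intro A hA
      obtain ⟨hA, hQA⟩ := mem_filter.1 hA
      have hmem : A \ Q ∈ Qᶜ.powersetCard k := by
        rw [mem_powersetCard, card_sdiff_of_subset hQA, (mem_powersetCard.1 hA).2]
        exact ⟨fun i hi => by simpa using (mem_sdiff.1 hi).2, by omega⟩
      rw [← mul_assoc, ← hunion n _ hmem, union_sdiff_of_subset hQA]
  have hrest : Tendsto (fun n => ∑ A ∈ univ.powersetCard (Q.card + k) with ¬ Q ⊆ A,
      subsetWeight μ (w n) A /
        (subsetWeight μ (w n) Q * weightedSubsetSum μ (u n) Qᶜ k 1) * g A) atTop (𝓝 0) := by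
    rw [← sum_const_zero (ι := Finset ι)
      (s := {A ∈ univ.powersetCard (Q.card + k) | ¬ Q ⊆ A})]
    refine tendsto_finsetSum _ fun A hA => ?_
    obtain ⟨hA, hQA⟩ := mem_filter.1 hA
    obtain ⟨B, hB, hlim⟩ := tendsto_subsetWeight_div_zero hw hQ (mem_powersetCard.1 hA).2 hQA
    have hle : ∀ n, subsetWeight μ (w n) (Q ∪ B) ≤
        subsetWeight μ (w n) Q * weightedSubsetSum μ (u n) Qᶜ k 1 := fun n => by
      simp only [weightedSubsetSum, Pi.one_apply, mul_one, mul_sum]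
      rw [← sum_congr rfl (hunion n)]
      exact single_le_sum (f := fun B => subsetWeight μ (w n) (Q ∪ B))
        (fun B _ => (hpos n _).le) hB
    simpa using (squeeze_zero
      (fun n => div_nonneg (hpos n A).le ((hpos n _).le.trans (hle n)))
      (fun n => div_le_div_of_nonneg_left (hpos n A).le (hpos n _) (hle n)) hlim).mul_const (g A)
  refine hrest.congr fun n => ?_
  have hsplit : weightedSubsetSum μ (w n) univ (Q.card + k) g =
      subsetWeight μ (w n) Q * weightedSubsetSum μ (u n) Qᶜ k (fun B => g (Q ∪ B)) +
        ∑ A ∈ univ.powersetCard (Q.card + k) with ¬ Q ⊆ A, subsetWeight μ (w n) A * g A := by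
    rw [← hmain, sum_filter_add_sum_filter_not, weightedSubsetSum]
  rw [hsplit, add_div, mul_div_mul_left _ _ (hpos n Q).ne', add_sub_cancel_left, sum_div]
  exact sum_congr rfl fun A _ => by ring

lemma tendsto_hankel_div (hμ : Function.Injective μ) (hw : ∀ n i, 0 < w n i)
    (hQ : ∀ i ∈ Q, ∀ j ∉ Q, Tendsto (fun n => w n j / w n i) atTop (𝓝 0))
    {u : ℕ → ι → ℝ} (hu : ∀ n j, u n j = (∏ t ∈ Q, (μ t - μ j) ^ 2) * w n j)
    (hpos : ∀ n, ∀ j ∈ Qᶜ, 0 < u n j) {k : ℕ} (hk : k ≤ Qᶜ.card) :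
    Tendsto (fun n => weightedSubsetSum μ (w n) univ (Q.card + k) 1 /
      (subsetWeight μ (w n) Q * weightedSubsetSum μ (u n) Qᶜ k 1)) atTop (𝓝 1) := by
  have h := (tendsto_weightedSubsetSum_div_sub hμ hw hQ hu k 1).add_const 1
  rw [zero_add] at h
  refine h.congr fun n => ?_
  have : weightedSubsetSum μ (u n) Qᶜ k (fun B => (1 : Finset ι → ℝ) (Q ∪ B)) =
    weightedSubsetSum μ (u n) Qᶜ k 1 := rfl
  rw [this, div_self (weightedSubsetSum_one_pos hμ (hpos n) hk).ne', sub_add_cancel]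

lemma tendsto_average_div (hμ : Function.Injective μ) (hw : ∀ n i, 0 < w n i)
    (hQ : ∀ i ∈ Q, ∀ j ∉ Q, Tendsto (fun n => w n j / w n i) atTop (𝓝 0))
    {u : ℕ → ι → ℝ} (hu : ∀ n j, u n j = (∏ t ∈ Q, (μ t - μ j) ^ 2) * w n j)
    (hpos : ∀ n, ∀ j ∈ Qᶜ, 0 < u n j) {k : ℕ} (hk : k ≤ Qᶜ.card) {L : ℝ}
    (hL : Tendsto (fun n => weightedSubsetSum μ (u n) Qᶜ k (fun A => ∑ i ∈ A, μ i) /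
      weightedSubsetSum μ (u n) Qᶜ k 1) atTop (𝓝 L)) :
    Tendsto (fun n => weightedSubsetSum μ (w n) univ (Q.card + k) (fun A => ∑ i ∈ A, μ i) /
      weightedSubsetSum μ (w n) univ (Q.card + k) 1) atTop (𝓝 (∑ i ∈ Q, μ i + L)) := by
  have hD := tendsto_hankel_div hμ hw hQ hu hpos hk
  have hE := ((tendsto_weightedSubsetSum_div_sub hμ hw hQ hu k (fun A => ∑ i ∈ A, μ i)).add
    (hL.const_add (∑ i ∈ Q, μ i))).div hD one_ne_zero
  rw [zero_add, div_one] at hE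
  refine hE.congr fun n => ?_
  have hne := (weightedSubsetSum_one_pos hμ (hpos n) hk).ne'
  have hadd : weightedSubsetSum μ (u n) Qᶜ k (fun B => ∑ i ∈ Q ∪ B, μ i) =
      (∑ i ∈ Q, μ i) * weightedSubsetSum μ (u n) Qᶜ k 1 +
        weightedSubsetSum μ (u n) Qᶜ k (fun A => ∑ i ∈ A, μ i) := by
    rw [weightedSubsetSum, weightedSubsetSum, weightedSubsetSum, mul_sum, ← sum_add_distrib]
    refine sum_congr rfl fun B hB => ?_
    rw [sum_union (disjoint_left.2 fun i hi hiB =>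
      (mem_compl.1 ((mem_powersetCard.1 hB).1 hiB)) hi), Pi.one_apply]
    ring
  have hM : subsetWeight μ (w n) Q * weightedSubsetSum μ (u n) Qᶜ k 1 ≠ 0 :=
    mul_ne_zero (subsetWeight_pos hμ Q fun i _ => hw n i).ne' hne
  rw [Pi.div_apply, hadd, add_div ((∑ i ∈ Q, μ i) * _), mul_div_cancel_right₀ _ hne, sub_add_cancel,
    div_div_div_cancel_right₀ hM]

end Asymptotics

section Restriction

variable {d : ℕ} (R : Finset (Fin d)) (μ v : Fin d → ℝ)

lemma weightedSubsetSum_restr (n : ℕ) (g : Finset (Fin d) → ℝ) :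
    weightedSubsetSum (restr R μ) (restr R v) univ n
      (fun A => g (A.map (R.orderEmbOfFin rfl).toEmbedding)) = weightedSubsetSum μ v R n g := by
  conv_rhs => rw [← map_orderEmbOfFin_univ R rfl]
  exact weightedSubsetSum_map μ v (R.orderEmbOfFin rfl).toEmbedding univ n g

lemma weightedSubsetSum_restr_one (n : ℕ) :
    weightedSubsetSum (restr R μ) (restr R v) univ n 1 = weightedSubsetSum μ v R n 1 :=
  weightedSubsetSum_restr R μ v n 1

lemma weightedSubsetSum_restr_sum (n : ℕ) :
    weightedSubsetSum (restr R μ) (restr R v) univ n (fun A => ∑ k ∈ A, restr R μ k) =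
      weightedSubsetSum μ v R n (fun A => ∑ k ∈ A, μ k) := by
  rw [← weightedSubsetSum_restr R μ v n (fun A => ∑ k ∈ A, μ k)]
  simp only [sum_map]
  rfl

lemma restr_injective {μ : Fin d → ℝ} (hμ : Function.Injective μ) :
    Function.Injective (restr R μ) :=
  hμ.comp (R.orderEmbOfFin rfl).injective

lemma restr_pos {v : Fin d → ℝ} (hv : ∀ i ∈ R, 0 < v i) (k : Fin R.card) : 0 < restr R v k :=
  hv _ (orderEmbOfFin_mem R rfl k)

end Restriction

lemma exists_tendsto_fEnt_of_Jmat {m : ℕ} {μ : Fin m → ℝ} {v : ℕ → Fin m → ℝ}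
    (h : ∀ p q : Fin m, ∃ L : ℝ, Tendsto (fun n => Jmat μ (v n) p q) atTop (𝓝 L)) {N : ℕ}
    (hN : 1 ≤ N) (hNm : N < 2 * m) : ∃ L : ℝ, Tendsto (fun n => fEnt μ (v n) N) atTop (𝓝 L) := by
  obtain ⟨L, hL⟩ := h ⟨(N - 1) / 2, by omega⟩ ⟨N / 2, by omega⟩
  refine ⟨L, hL.congr fun n => ?_⟩
  simp only [Jmat, Matrix.of_apply, Fin.mk.injEq]
  split_ifs with h1 h2
  · rw [show 2 * ((N - 1) / 2) + 1 = N by omega]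
  · rw [show (N - 1) / 2 + N / 2 + 1 = N by omega]
  · omega

/-- Lemma 16: convergence of the last entries to those of the
reweighted restricted system. -/
theorem stmt4 {d r : ℕ} (hd : 1 ≤ d) (lam : Fin d → ℝ) (hlam : Function.Injective lam)
    (w : ℕ → Fin d → ℝ) (hstab : Stable w)
    (S : Fin r → Finset (Fin d)) (hS : LimPart w S) (hr : 2 ≤ r)
    (m : ℕ) (hm1 : 1 ≤ m) (hmr : m < r)
    (Q R : Finset (Fin d))
    (hQ : Q = (Finset.univ.filter (fun j : Fin r => (j : ℕ) < m)).biUnion S)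
    (hR : R = (Finset.univ.filter (fun j : Fin r => m ≤ (j : ℕ))).biUnion S)
    (u : ℕ → Fin d → ℝ) (hu : ∀ n j, u n j = Cc lam j Q * w n j)
    (hconv : ∀ p q : Fin R.card, ∃ L : ℝ,
      Tendsto (fun n => Jmat (restr R lam) (restr R (u n)) p q) atTop (𝓝 L)) :
    ∀ N : ℕ, 2 * Q.card + 1 ≤ N → N ≤ 2 * d - 1 →
      ∃ L : ℝ, Tendsto (fun n => fEnt lam (w n) N) atTop (𝓝 L) ∧
        Tendsto (fun n => fEnt (restr R lam) (restr R (u n)) (N - 2 * Q.card))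
          atTop (𝓝 L) := by
  have hw := hstab.1
  obtain ⟨⟨-, hdisj, hcover⟩, -, hlim⟩ := hS
  have hRQ : R = Qᶜ := by
    ext i
    obtain ⟨a, -, ha⟩ := mem_biUnion.1 (hcover ▸ mem_univ i)
    have huniq : ∀ b, i ∈ S b → b = a := fun b hb => by
      by_contra hne
      exact disjoint_left.1 (hdisj b a hne) hb ha
    simp only [hQ, hR, mem_compl, mem_biUnion, mem_filter, mem_univ, true_and, not_exists, not_and]
    constructor
    · rintro ⟨b, hb, hib⟩ c hc hic
      rw [huniq b hib] at hb
      rw [huniq c hic] at hc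
      omega
    · exact fun h => ⟨a, not_lt.1 fun hlt => h a hlt ha, ha⟩
  have hdom : ∀ i ∈ Q, ∀ j ∉ Q, Tendsto (fun n => w n j / w n i) atTop (𝓝 0) := fun i hi j hj => by
    have hj' : j ∈ R := by rw [hRQ, mem_compl]; exact hj
    rw [hQ, mem_biUnion] at hi
    rw [hR, mem_biUnion] at hj'
    obtain ⟨a, ha, hia⟩ := hi
    obtain ⟨b, hb, hjb⟩ := hj'
    have hab : a < b := Fin.lt_def.2 ((mem_filter.1 ha).2.trans_le (mem_filter.1 hb).2)
    exact (hlim a b hab i hia j hjb).inv_tendsto_atTop.congr fun n => by simp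
  have hupos : ∀ n, ∀ j ∈ R, 0 < u n j := fun n j hj => by
    rw [hu]
    refine mul_pos (prod_pos fun t ht => sq_pos_of_ne_zero (sub_ne_zero.2 (hlam.ne ?_))) (hw n j)
    rintro rfl
    rw [hRQ, mem_compl] at hj
    exact hj ht
  have hcard : Q.card + R.card = d := by rw [hRQ, card_add_card_compl, Fintype.card_fin]
  have hinj := restr_injective R hlam
  have hrpos : ∀ n k, 0 < restr R (u n) k := fun n => restr_pos R (hupos n)
  clear hQ hR hlim hcover hdisj
  subst hRQ
  have havg : ∀ k ≤ Qᶜ.card, ∃ L, Tendsto (fun n =>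
      weightedSubsetSum lam (u n) Qᶜ k (fun A => ∑ i ∈ A, lam i) /
        weightedSubsetSum lam (u n) Qᶜ k 1) atTop (𝓝 L) := fun k => by
    induction k with
    | zero => exact fun _ => ⟨0, by simp [weightedSubsetSum]⟩
    | succ k ih =>
      intro hk
      obtain ⟨L, hL⟩ := ih (by omega)
      obtain ⟨L', hL'⟩ := exists_tendsto_fEnt_of_Jmat hconv (N := 2 * k + 1) (by omega) (by omega)
      refine ⟨L' + L, (hL'.add hL).congr fun n => ?_⟩
      rw [fEnt_odd hinj (hrpos n) hk]
      simp only [weightedSubsetSum_restr_one, weightedSubsetSum_restr_sum, sub_add_cancel]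
  intro N hN hNd
  rcases Nat.even_or_odd' N with ⟨l, rfl | rfl⟩
  · obtain ⟨k, rfl⟩ : ∃ k, l = Q.card + k + 1 := ⟨l - Q.card - 1, by omega⟩
    obtain ⟨L, hL⟩ := exists_tendsto_fEnt_of_Jmat hconv (N := 2 * (k + 1)) (by omega) (by omega)
    refine ⟨L, ?_, by rwa [show 2 * (Q.card + k + 1) - 2 * Q.card = 2 * (k + 1) by omega]⟩
    have h0 := tendsto_hankel_div hlam hw hdom hu hupos (k := k) (by omega)
    have h1 := tendsto_hankel_div hlam hw hdom hu hupos (k := k + 1) (by omega)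
    have h2 := tendsto_hankel_div hlam hw hdom hu hupos (k := k + 2) (by omega)
    have hlim := hL.mul (((h2.div h1 one_ne_zero).div (h1.div h0 one_ne_zero) (by simp)).sqrt)
    simp only [div_one, Real.sqrt_one, mul_one] at hlim
    refine hlim.congr fun n => ?_
    have hD : ∀ l ≤ Qᶜ.card, weightedSubsetSum lam (u n) Qᶜ l 1 ≠ 0 := fun l hl =>
      (weightedSubsetSum_one_pos hlam (hupos n) hl).ne'
    have hD0 := hD k (by omega)
    have hD1 := hD (k + 1) (by omega)
    have hD2 := hD (k + 2) (by omega)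
    have hq := (subsetWeight_pos hlam Q fun i _ => hw n i).ne'
    have hF : ∀ l ≤ d, 0 < weightedSubsetSum lam (w n) univ l 1 := fun l hl =>
      weightedSubsetSum_one_pos hlam (fun i _ => hw n i) (by simpa)
    have hF0 := hF (Q.card + k) (by omega)
    have hF1 := hF (Q.card + k + 1) (by omega)
    rw [fEnt_even hinj (hrpos n) (by omega), fEnt_even hlam (hw n) (by omega)]
    simp only [weightedSubsetSum_restr_one, Pi.div_apply]
    rw [← Real.sqrt_mul]
    · congr 1
      simp only [← add_assoc]
      field_simp
    · have hD' : ∀ l ≤ Qᶜ.card, 0 < weightedSubsetSum lam (u n) Qᶜ l 1 := fun l hl =>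
        weightedSubsetSum_one_pos hlam (hupos n) hl
      have hD0 := hD' k (by omega)
      have hD1 := hD' (k + 1) (by omega)
      have hD2 := hD' (k + 2) (by omega)
      positivity
  · obtain ⟨k, rfl⟩ : ∃ k, l = Q.card + k := ⟨l - Q.card, by omega⟩
    obtain ⟨L, hL⟩ := havg k (by omega)
    obtain ⟨L', hL'⟩ := havg (k + 1) (by omega)
    refine ⟨L' - L, ?_, ?_⟩
    · have hlim := (tendsto_average_div hlam hw hdom hu hupos (by omega) hL').sub
        (tendsto_average_div hlam hw hdom hu hupos (by omega) hL)
      rw [add_sub_add_left_eq_sub] at hlim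
      exact hlim.congr fun n => (fEnt_odd hlam (hw n) (by omega)).symm
    · rw [show 2 * (Q.card + k) + 1 - 2 * Q.card = 2 * k + 1 by omega]
      refine (hL'.sub hL).congr fun n => ?_
      rw [fEnt_odd hinj (hrpos n) (by omega)]
      simp only [weightedSubsetSum_restr_one, weightedSubsetSum_restr_sum]
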